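/- arXiv:math/0310385 — 3 statements merged into one kernel-verified Lean document; each statement's English description precedes it below -/
import Mathlib

section
/- For every prime power q ≥ 2 and every fixed integer R ≥ 1 and every ε > 0, there exists N such that for all n ≥ N there is an (n,R,q)-de Bruijn covering code of length at most (R+1+ε)·q^n·(log n)/(binom(n,R)·(q−1)^R); that is, M(n,R,q) ≤ (R+1+ε)·q^n·log n/(binom(n,R)·(q−1)^R) for all sufficiently large n. -/
/-- The length-`n` cyclic window of the string `S` starting at index `i`. -/
def cyclicWindow {M : ℕ} (q n : ℕ) (S : ZMod M → Fin q) (i : ZMod M) : Fin n → Fin q :=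
  fun t => S (i + (t : ℕ))

/-- `S` is an `(n,R,q)`-de Bruijn covering code: every `q`-ary `n`-word is within Hamming
distance `R` of some cyclic window of `S`. -/
def IsDeBruijnCoveringCode (q n R M : ℕ) (S : ZMod M → Fin q) : Prop :=
  ∀ v : Fin n → Fin q, ∃ i : ZMod M, hammingDist (cyclicWindow q n S i) v ≤ R

/-- `M(n,R,q)`, the smallest length of an `(n,R,q)`-de Bruijn covering code. -/
noncomputable def deBruijnCoveringNumber (q n R : ℕ) : ℕ :=
  sInf {M : ℕ | 0 < M ∧ ∃ S : ZMod M → Fin q, IsDeBruijnCoveringCode q n R M S}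

section

open Finset

/-- The length-`n` window of a word of length `ℓ + n` starting at index `i`. -/
def blockWindow {A : Type*} {l n : ℕ} (x : Fin (l + n) → A) (i : Fin l) : Fin n → A :=
  fun t => x ⟨i + t, by omega⟩

/-- A solution of `x s - x (s + k) = d` on a window starting at `j`, vanishing elsewhere. -/
def shiftSolution {A : Type*} [AddCommGroup A] (n j k : ℕ) (d : ℕ → A) (s : ℕ) : A :=
  if _ : j ≤ s ∧ s < j + n ∧ 0 < k ∧ k ≤ s then
    shiftSolution n j k d (s - k) - d (s - j)
  else 0
termination_by s
decreasing_by omega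

/-- The list `L` contains a contiguous word differing from `v` by an element of `E`. -/
def ListCovers {A : Type*} [AddCommGroup A] {n : ℕ} (E : Finset (Fin n → A)) (L : List A)
    (v : Fin n → A) : Prop :=
  ∃ w : Fin n → A, w - v ∈ E ∧ List.ofFn w <:+: L

lemma ListCovers.mono {A : Type*} [AddCommGroup A] {n : ℕ} {E : Finset (Fin n → A)}
    {L L' : List A} {v : Fin n → A}
    (h : ListCovers E L v) (hL : L <:+: L') : ListCovers E L' v := by
  obtain ⟨w, hw, hi⟩ := h
  exact ⟨w, hw, hi.trans hL⟩

lemma isInfix_ofFn_blockWindow {A : Type*} {l n : ℕ} (x : Fin (l + n) → A) (i : Fin l) :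
    List.ofFn (blockWindow x i) <:+: List.ofFn x := by
  have h : List.ofFn (blockWindow x i) = ((List.ofFn x).drop i).take n := by
    apply List.ext_getElem
    · simp; omega
    · intro t h1 h2
      simp [blockWindow]
  rw [h]
  have h1 : ((List.ofFn x).drop i).take n <:+: (List.ofFn x).drop i :=
    ⟨[], _, List.take_append_drop n _⟩
  exact h1.trans (List.drop_suffix _ _).isInfix

lemma exists_list_covering {A : Type*} [AddCommGroup A] [DecidableEq A] {n : ℕ}
    {E : Finset (Fin n → A)} (hE : E.Nonempty)
    (U : Finset (Fin n → A)) :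
    ∃ L : List A, L.length = #U * n ∧ ∀ v ∈ U, ListCovers E L v := by
  induction U using Finset.induction_on with
  | empty => exact ⟨[], by simp, by simp⟩
  | insert u U hu ih =>
    obtain ⟨L, hL, hcov⟩ := ih
    obtain ⟨e, he⟩ := hE
    refine ⟨L ++ List.ofFn (e + u), ?_, ?_⟩
    · simp [hL, card_insert_of_notMem hu]; ring
    · intro v hv
      rcases mem_insert.1 hv with rfl | hv
      · exact ⟨e + v, by simpa using he, (List.suffix_append _ _).isInfix⟩
      · exact (hcov v hv).mono (List.prefix_append _ _).isInfix

section Counting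

variable {A : Type*} [AddCommGroup A] [Fintype A] [DecidableEq A]

lemma card_fiber_of_surjective {G H : Type*} [AddCommGroup G] [AddCommGroup H] [Fintype G]
    [Fintype H] [DecidableEq H] (f : G →+ H) (hf : Function.Surjective f) (y : H) :
    Fintype.card H * #{x | f x = y} = Fintype.card G := by
  have h : ∀ z : H, #{x | f x = z} = #{x | f x = y} := fun z =>
    AddMonoidHom.card_fiber_eq_of_mem_range f (hf z) (hf y)
  have h2 := Finset.card_eq_sum_card_fiberwise (f := f) (s := (univ : Finset G))
    (t := (univ : Finset H)) (fun _ _ => by simp)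
  simp only [h, sum_const, smul_eq_mul] at h2
  simpa using h2.symm

lemma card_fiber_words {l n : ℕ} (f : (Fin (l + n) → A) →+ (Fin n → A))
    (hf : Function.Surjective f) (y : Fin n → A) :
    #{x | f x = y} = Fintype.card A ^ l := by
  have h := card_fiber_of_surjective f hf y
  simp only [Fintype.card_fun, Fintype.card_fin, pow_add] at h
  have hpos : 0 < Fintype.card A ^ n := pow_pos Fintype.card_pos n
  rw [mul_comm (_ ^ l)] at h
  exact Nat.eq_of_mul_eq_mul_left hpos h

lemma card_blockWindow_eq {l n : ℕ} (i : Fin l) (y : Fin n → A) :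
    #{x : Fin (l + n) → A | blockWindow x i = y} = Fintype.card A ^ l := by
  have hsurj : Function.Surjective fun x : Fin (l + n) → A => blockWindow x i := by
    intro z
    refine ⟨fun s => if h : (i : ℕ) ≤ s ∧ (s : ℕ) - i < n then z ⟨s - i, h.2⟩ else 0, ?_⟩
    funext t
    simp [blockWindow]
  exact card_fiber_words
    (AddMonoidHom.mk' (fun x : Fin (l + n) → A => blockWindow x i) fun _ _ => rfl) hsurj y

lemma card_blockWindow_sub_eq_of_lt {l n : ℕ} {i j : Fin l} (hij : i < j) (d : Fin n → A) :
    #{x : Fin (l + n) → A | blockWindow x i - blockWindow x j = d} = Fintype.card A ^ l := by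
  refine card_fiber_words (AddMonoidHom.mk'
    (fun x : Fin (l + n) → A => blockWindow x i - blockWindow x j) fun x y => ?_) ?_ d
  · funext t
    simp only [blockWindow, Pi.add_apply, Pi.sub_apply]
    abel
  · intro z
    refine ⟨fun s => shiftSolution n j (j - i)
      (fun t => if h : t < n then z ⟨t, h⟩ else 0) s, ?_⟩
    funext t
    have hij' : (i : ℕ) < j := hij
    simp only [AddMonoidHom.mk'_apply, Pi.sub_apply, blockWindow]
    nth_rewrite 2 [shiftSolution]
    rw [dif_pos (by omega)]
    have h1 : (j : ℕ) + t - (j - i) = i + t := by omega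
    simp [h1]

lemma card_blockWindow_sub_eq {l n : ℕ} {i j : Fin l} (hij : i ≠ j) (d : Fin n → A) :
    #{x : Fin (l + n) → A | blockWindow x i - blockWindow x j = d} = Fintype.card A ^ l := by
  rcases lt_or_gt_of_ne hij with h | h
  · exact card_blockWindow_sub_eq_of_lt h d
  · rw [← card_blockWindow_sub_eq_of_lt h (-d)]
    congr 1
    ext x
    simp only [mem_filter, mem_univ, true_and]
    rw [← neg_inj, neg_sub]

lemma sum_card_near {l n : ℕ} (E : Finset (Fin n → A)) (i : Fin l) (v : Fin n → A) :
    #{x : Fin (l + n) → A | blockWindow x i - v ∈ E} = #E * Fintype.card A ^ l := by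
  rw [Finset.card_eq_sum_card_fiberwise (f := fun x => blockWindow x i - v) (t := E)
    (fun x hx => by simpa using hx)]
  rw [← smul_eq_mul, ← sum_const]
  refine sum_congr rfl fun e he => ?_
  rw [← card_blockWindow_eq i (e + v)]
  congr 1
  ext x
  simp only [mem_filter, mem_univ, true_and, sub_eq_iff_eq_add]
  constructor
  · exact fun h => h.2
  · intro h
    exact ⟨by simpa [h] using he, h⟩

lemma sum_card_near_pair_le {l n : ℕ} (E : Finset (Fin n → A)) {i j : Fin l} (hij : i ≠ j) :
    ∑ x : Fin (l + n) → A, #{v | blockWindow x i - v ∈ E ∧ blockWindow x j - v ∈ E} ≤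
      #E ^ 2 * Fintype.card A ^ l := by
  calc
    _ ≤ ∑ x : Fin (l + n) → A,
        #{p ∈ E ×ˢ E | blockWindow x i - blockWindow x j = p.1 - p.2} := by
      refine sum_le_sum fun x _ => ?_
      refine card_le_card_of_injOn (fun v => (blockWindow x i - v, blockWindow x j - v)) ?_ ?_
      · intro v hv
        simpa using hv
      · intro v _ w _ h
        simpa using (Prod.ext_iff.1 h).1
    _ = ∑ p ∈ E ×ˢ E,
        #{x : Fin (l + n) → A | blockWindow x i - blockWindow x j = p.1 - p.2} := by
      simp only [card_filter]
      exact sum_comm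
    _ = _ := by
      simp only [card_blockWindow_sub_eq hij, sum_const, card_product, smul_eq_mul, sq]

/-- The bound `N - N (N - 1) ≤ 1` for the number `N` of elements satisfying `P`. -/
lemma card_le_indicator_add_offDiag {ι : Type*} [Fintype ι] [DecidableEq ι] (P : ι → Prop)
    [DecidablePred P] [Decidable (∃ i, P i)] :
    #{i | P i} ≤ (if ∃ i, P i then 1 else 0) + #{p ∈ (univ : Finset ι).offDiag | P p.1 ∧ P p.2} := by
  have h : {p ∈ (univ : Finset ι).offDiag | P p.1 ∧ P p.2} =
      ({i | P i} : Finset ι).offDiag := by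
    ext p
    simp [mem_offDiag]
    tauto
  rw [h, offDiag_card]
  split_ifs with hP
  · have : 1 ≤ #{i | P i} := by
      obtain ⟨i, hi⟩ := hP
      exact card_pos.2 ⟨i, by simpa using hi⟩
    obtain ⟨k, hk⟩ := Nat.exists_eq_add_of_le this
    rw [hk]
    have : (1 + k) * (1 + k) - (1 + k) = (1 + k) * k := by
      rw [← Nat.mul_sub_one]; simp
    rw [this]
    nlinarith
  · have : ({i | P i} : Finset ι) = ∅ := by
      ext i
      simpa using fun hi => hP ⟨i, hi⟩
    simp [this]

lemma sum_card_covered_ge {l n : ℕ} (E U : Finset (Fin n → A)) :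
    #U * (l * (#E * Fintype.card A ^ l)) ≤
      ∑ x : Fin (l + n) → A, #{v ∈ U | ∃ i, blockWindow x i - v ∈ E} +
        l ^ 2 * (#E ^ 2 * Fintype.card A ^ l) := by
  calc
    _ = ∑ x : Fin (l + n) → A, ∑ v ∈ U, #{i | blockWindow x i - v ∈ E} := by
      rw [sum_comm]
      have : ∀ v ∈ U, ∑ x : Fin (l + n) → A, #{i | blockWindow x i - v ∈ E} =
          l * (#E * Fintype.card A ^ l) := by
        intro v _
        simp only [card_filter]
        rw [sum_comm]
        simp only [← card_filter, sum_card_near]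
        simp
      rw [sum_congr rfl this, sum_const, smul_eq_mul]
    _ ≤ ∑ x : Fin (l + n) → A, ∑ v ∈ U, ((if ∃ i, blockWindow x i - v ∈ E then 1 else 0) +
          #{p ∈ (univ : Finset (Fin l)).offDiag |
            blockWindow x p.1 - v ∈ E ∧ blockWindow x p.2 - v ∈ E}) :=
      sum_le_sum fun x _ => sum_le_sum fun v _ => card_le_indicator_add_offDiag _
    _ ≤ ∑ x : Fin (l + n) → A, #{v ∈ U | ∃ i, blockWindow x i - v ∈ E} +
        ∑ x : Fin (l + n) → A, ∑ v, #{p ∈ (univ : Finset (Fin l)).offDiag |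
            blockWindow x p.1 - v ∈ E ∧ blockWindow x p.2 - v ∈ E} := by
      rw [← sum_add_distrib]
      refine sum_le_sum fun x _ => ?_
      rw [sum_add_distrib, card_filter]
      gcongr
      exact subset_univ U
    _ ≤ _ := by
      gcongr
      calc
        _ = ∑ p ∈ (univ : Finset (Fin l)).offDiag, ∑ x : Fin (l + n) → A,
            #{v | blockWindow x p.1 - v ∈ E ∧ blockWindow x p.2 - v ∈ E} := by
          rw [sum_comm (s := (univ : Finset (Fin l)).offDiag)]
          refine sum_congr rfl fun x _ => ?_
          simp only [card_filter]
          exact sum_comm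
        _ ≤ ∑ p ∈ (univ : Finset (Fin l)).offDiag, #E ^ 2 * Fintype.card A ^ l :=
          sum_le_sum fun p hp => sum_card_near_pair_le E (by simpa using hp)
        _ ≤ _ := by
          rw [sum_const, smul_eq_mul]
          gcongr
          rw [offDiag_card]
          simp [sq]

lemma exists_block_uncovered_le {l n : ℕ} (E U : Finset (Fin n → A)) {a : ℝ}
    (ha : a * (Fintype.card A : ℝ) ^ n = l * #E) :
    ∃ x : Fin (l + n) → A, (#{v ∈ U | ¬ ∃ i, blockWindow x i - v ∈ E} : ℝ) ≤
      (1 - a) * #U + a ^ 2 * (Fintype.card A : ℝ) ^ n := by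
  by_contra hcon
  have hQ : (0 : ℝ) < Fintype.card A := by exact_mod_cast Fintype.card_pos (α := A)
  set Q : ℝ := (Fintype.card A : ℝ) with hQdef
  have h1 : ∀ x : Fin (l + n) → A, (#{v ∈ U | ∃ i, blockWindow x i - v ∈ E} : ℝ) <
      a * #U - a ^ 2 * Q ^ n := by
    intro x
    have h2 : (#{v ∈ U | ∃ i, blockWindow x i - v ∈ E} : ℝ) +
        #{v ∈ U | ¬ ∃ i, blockWindow x i - v ∈ E} = #U := by
      exact_mod_cast card_filter_add_card_filter_not (s := U) _
    have := not_le.1 (not_exists.1 hcon x)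
    linarith
  have h3 : (∑ x : Fin (l + n) → A, (#{v ∈ U | ∃ i, blockWindow x i - v ∈ E} : ℝ)) <
      Q ^ (l + n) * (a * #U - a ^ 2 * Q ^ n) := by
    refine (sum_lt_sum_of_nonempty univ_nonempty fun x _ => h1 x).trans_eq ?_
    simp only [sum_const, card_univ, Fintype.card_fun, Fintype.card_fin, nsmul_eq_mul,
      Nat.cast_pow, hQdef]
  have h4 := sum_card_covered_ge (l := l) E U
  have h5 : (#U : ℝ) * (l * (#E * Q ^ l)) ≤
      (∑ x : Fin (l + n) → A, (#{v ∈ U | ∃ i, blockWindow x i - v ∈ E} : ℝ)) +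
        (l : ℝ) ^ 2 * ((#E : ℝ) ^ 2 * Q ^ l) := by
    rw [hQdef]
    exact_mod_cast h4
  have h6 : (#U : ℝ) * (l * (#E * Q ^ l)) = Q ^ (l + n) * (a * #U) := by
    rw [pow_add]
    linear_combination (-(#U : ℝ) * Q ^ l) * ha
  have h7 : (l : ℝ) ^ 2 * ((#E : ℝ) ^ 2 * Q ^ l) = Q ^ (l + n) * (a ^ 2 * Q ^ n) := by
    rw [pow_add]
    linear_combination (-Q ^ l * (a * Q ^ n + l * #E)) * ha
  rw [h6, h7] at h5
  linarith

lemma exists_list_uncovered_le {n : ℕ} (l : ℕ) (E : Finset (Fin n → A)) {a : ℝ}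
    (ha : a * (Fintype.card A : ℝ) ^ n = l * #E) (ha1 : a ≤ 1) (m : ℕ) :
    ∃ (L : List A) (U : Finset (Fin n → A)), L.length = m * (l + n) ∧
      (∀ v ∉ U, ListCovers E L v) ∧
      (#U : ℝ) ≤ (Fintype.card A : ℝ) ^ n * ((1 - a) ^ m + a) := by
  have hQ : (0 : ℝ) < (Fintype.card A : ℝ) ^ n :=
    pow_pos (by exact_mod_cast Fintype.card_pos (α := A)) n
  have ha0 : 0 ≤ a := nonneg_of_mul_nonneg_left (by rw [ha]; positivity) hQ
  induction m with
  | zero =>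
    refine ⟨[], univ, by simp, by simp, ?_⟩
    simp
    nlinarith
  | succ m ih =>
    obtain ⟨L, U, hL, hcov, hU⟩ := ih
    obtain ⟨x, hx⟩ := exists_block_uncovered_le E U ha
    refine ⟨L ++ List.ofFn x, {v ∈ U | ¬ ∃ i, blockWindow x i - v ∈ E}, ?_, ?_, ?_⟩
    · simp [hL]; ring
    · intro v hv
      by_cases hvU : v ∈ U
      · have : ∃ i, blockWindow x i - v ∈ E := by
          by_contra hc
          exact hv (mem_filter.2 ⟨hvU, hc⟩)
        obtain ⟨i, hi⟩ := this
        exact ⟨_, hi, (isInfix_ofFn_blockWindow x i).trans (List.suffix_append _ _).isInfix⟩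
      · exact (hcov v hvU).mono (List.prefix_append _ _).isInfix
    · refine hx.trans ?_
      have := mul_le_mul_of_nonneg_left hU (sub_nonneg.2 ha1)
      refine (add_le_add_left this _).trans_eq ?_
      ring

/-- The words of Hamming weight `R`. -/
def weightSphere (A : Type*) [AddCommGroup A] [Fintype A] [DecidableEq A] (n R : ℕ) :
    Finset (Fin n → A) :=
  {e | hammingNorm e = R}

lemma card_weightSphere (n R : ℕ) :
    #(weightSphere A n R) = n.choose R * (Fintype.card A - 1) ^ R := by
  have h := Finset.card_eq_sum_card_fiberwise (s := weightSphere A n R)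
    (f := fun e => ({i | e i ≠ 0} : Finset (Fin n))) (t := powersetCard R univ)
    (fun e he => by simpa [weightSphere, hammingNorm, mem_powersetCard] using he)
  rw [h]
  have hfib : ∀ T ∈ powersetCard R (univ : Finset (Fin n)),
      #{e ∈ weightSphere A n R | ({i | e i ≠ 0} : Finset (Fin n)) = T} =
        (Fintype.card A - 1) ^ R := by
    intro T hT
    have hT' := (mem_powersetCard.1 hT).2
    have : {e ∈ weightSphere A n R | ({i | e i ≠ 0} : Finset (Fin n)) = T} =
        Fintype.piFinset fun i => if i ∈ T then (univ.erase 0 : Finset A) else {0} := by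
      ext e
      simp only [weightSphere, mem_filter, mem_univ, true_and, Fintype.mem_piFinset]
      constructor
      · rintro ⟨-, rfl⟩ i
        by_cases hi : e i = 0 <;> simp [hi]
      · intro he
        have hs : ({i | e i ≠ 0} : Finset (Fin n)) = T := by
          ext i
          have := he i
          by_cases hi : i ∈ T <;> simp_all
        exact ⟨by rw [hammingNorm, hs, hT'], hs⟩
    rw [this, Fintype.card_piFinset, ← hT']
    simp [apply_ite]
  rw [sum_congr rfl hfib]
  simp

end Counting

lemma deBruijnCoveringNumber_le_of_list {q n R : ℕ} [NeZero q] (hn : 0 < n) (L : List (Fin q))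
    (hL : ∀ v, ListCovers (weightSphere (Fin q) n R) L v) :
    deBruijnCoveringNumber q n R ≤ L.length := by
  have hpos : 0 < L.length := by
    obtain ⟨w, -, h⟩ := hL 0
    simpa using hn.trans_le (by simpa using h.length_le)
  have : NeZero L.length := ⟨hpos.ne'⟩
  refine Nat.sInf_le ⟨hpos, fun z => L[z.val]'(ZMod.val_lt z), fun v => ?_⟩
  obtain ⟨w, hw, s, t, hst⟩ := hL v
  refine ⟨(s.length : ZMod L.length), ?_⟩
  have hcw : cyclicWindow q n (fun z : ZMod L.length => L[z.val]'(ZMod.val_lt z)) s.length = w := by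
    funext k
    have hlen : L.length = s.length + n + t.length := by
      rw [← hst]; simp [add_assoc]
    have hval : ((s.length : ZMod L.length) + ((k : ℕ) : ZMod L.length)).val = s.length + k := by
      rw [← Nat.cast_add, ZMod.val_natCast, Nat.mod_eq_of_lt (by omega)]
    simp only [cyclicWindow, hval]
    have : L[s.length + (k : ℕ)]'(by omega) =
        (s ++ List.ofFn w ++ t)[s.length + (k : ℕ)]'(by simp; omega) := by
      congr 1; exact hst.symm
    rw [this, List.getElem_append_left (by simp), List.getElem_append_right (by simp)]
    simp
  rw [hcw, hammingDist_comm, hammingDist_eq_hammingNorm, neg_add_eq_sub]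
  have h1 : hammingNorm (w - v) = R := by simpa [weightSphere] using hw
  exact h1.le

lemma deBruijnCoveringNumber_le {q n R : ℕ} (hq : 2 ≤ q) (hn : 0 < n) (hR : R ≤ n) (l m : ℕ)
    {a : ℝ} (ha : a * (q : ℝ) ^ n = l * (n.choose R * ((q : ℝ) - 1) ^ R)) (ha1 : a ≤ 1) :
    (deBruijnCoveringNumber q n R : ℝ) ≤
      m * (l + n) + n * ((q : ℝ) ^ n * (Real.exp (-(a * m)) + a)) := by
  have : NeZero q := ⟨by omega⟩
  have hcard : (#(weightSphere (Fin q) n R) : ℝ) = n.choose R * ((q : ℝ) - 1) ^ R := by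
    rw [card_weightSphere, Fintype.card_fin]
    push_cast [Nat.cast_sub (show 1 ≤ q by omega)]
    rfl
  have hne : (weightSphere (Fin q) n R).Nonempty := by
    rw [← card_pos, card_weightSphere, Fintype.card_fin]
    exact Nat.mul_pos (Nat.choose_pos hR) (pow_pos (by omega) R)
  obtain ⟨L, U, hLlen, hcov, hU⟩ := exists_list_uncovered_le (A := Fin q) l
    (weightSphere (Fin q) n R) (a := a) (by rw [hcard, Fintype.card_fin, ha]) ha1 m
  obtain ⟨L', hL', hcov'⟩ := exists_list_covering hne U
  have h := deBruijnCoveringNumber_le_of_list hn (L ++ L') fun v => by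
    by_cases hv : v ∈ U
    · exact (hcov' v hv).mono (List.suffix_append _ _).isInfix
    · exact (hcov v hv).mono (List.prefix_append _ _).isInfix
  rw [List.length_append, hLlen, hL'] at h
  have h' : (deBruijnCoveringNumber q n R : ℝ) ≤ m * (l + n) + #U * n := by exact_mod_cast h
  rw [Fintype.card_fin] at hU
  have hexp : (1 - a) ^ m ≤ Real.exp (-(a * m)) := by
    have h1 : 1 - a ≤ Real.exp (-a) := Real.one_sub_le_exp_neg a
    calc (1 - a) ^ m ≤ Real.exp (-a) ^ m := pow_le_pow_left₀ (by linarith) h1 m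
      _ = _ := by rw [← Real.exp_nat_mul]; ring_nf
  have hU' : (#U : ℝ) ≤ (q : ℝ) ^ n * (Real.exp (-(a * m)) + a) :=
    hU.trans (by gcongr)
  have := mul_le_mul_of_nonneg_right hU' (Nat.cast_nonneg n : (0 : ℝ) ≤ n)
  linarith

end

/-- For every prime power `q ≥ 2`, every fixed `R ≥ 1` and every `ε > 0`, for all
sufficiently large `n` there is an `(n,R,q)`-de Bruijn covering code of length at most
`(R+1+ε) q^n log n / (C(n,R) (q-1)^R)`. -/
theorem stmt0 (q R : ℕ) (hq : 2 ≤ q) (hq' : ∃ p k : ℕ, p.Prime ∧ 0 < k ∧ q = p ^ k)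
    (hR : 1 ≤ R) (ε : ℝ) (hε : 0 < ε) :
    ∃ N : ℕ, ∀ n : ℕ, N ≤ n →
      (deBruijnCoveringNumber q n R : ℝ) ≤
        ((R : ℝ) + 1 + ε) * (q : ℝ) ^ n * Real.log n /
          ((n.choose R : ℝ) * ((q : ℝ) - 1) ^ R) := by
  have hq1 : (1 : ℝ) < q := by exact_mod_cast hq
  have hpoly := (tendsto_pow_const_div_const_pow_of_one_lt (2 * R + 3) hq1).eventually_lt_const
    (show (0 : ℝ) < 1 / (3 * (q : ℝ) ^ (2 * R)) by positivity)
  have hlog := ((Real.tendsto_log_atTop.comp tendsto_natCast_atTop_atTop).const_mul_atTop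
    hε).eventually_ge_atTop ((R : ℝ) + 1 + (q : ℝ) ^ R + 1)
  obtain ⟨N, hN⟩ := Filter.eventually_atTop.1 (hpoly.and hlog)
  refine ⟨max N (R + 1), fun n hn => ?_⟩
  obtain ⟨h1, h2⟩ := hN n ((le_max_left _ _).trans hn)
  have hRn : R + 1 ≤ n := (le_max_right _ _).trans hn
  simp only [Function.comp_apply] at h2
  have hn1 : (1 : ℝ) ≤ n := by exact_mod_cast (show 1 ≤ n by omega)
  have hn0 : (0 : ℝ) < n := by linarith
  have hQ : (0 : ℝ) < (q : ℝ) ^ n := by positivity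
  set V : ℝ := (n.choose R : ℝ) * ((q : ℝ) - 1) ^ R with hV
  have hV1 : 1 ≤ V := by
    have hc : (1 : ℝ) ≤ n.choose R := by
      exact_mod_cast Nat.choose_pos (show R ≤ n by omega)
    have hq2 : (1 : ℝ) ≤ (q : ℝ) - 1 := by
      have : (2 : ℝ) ≤ q := by exact_mod_cast hq
      linarith
    exact one_le_mul_of_one_le_of_one_le hc (one_le_pow₀ hq2)
  have hV0 : 0 < V := by linarith
  have hVle : V ≤ (n : ℝ) ^ R * (q : ℝ) ^ R := by
    have hc : (n.choose R : ℝ) ≤ (n : ℝ) ^ R := by exact_mod_cast Nat.choose_le_pow n R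
    have hq3 : ((q : ℝ) - 1) ^ R ≤ (q : ℝ) ^ R :=
      pow_le_pow_left₀ (by linarith) (by linarith) R
    exact mul_le_mul hc hq3 (pow_nonneg (by linarith) R) (by positivity)
  have hsmall : 3 * (n : ℝ) ^ 3 * V ^ 2 ≤ (q : ℝ) ^ n := by
    rw [div_lt_div_iff₀ hQ (by positivity)] at h1
    calc 3 * (n : ℝ) ^ 3 * V ^ 2 ≤ 3 * (n : ℝ) ^ 3 * ((n : ℝ) ^ R * (q : ℝ) ^ R) ^ 2 := by gcongr
      _ = (n : ℝ) ^ (2 * R + 3) * (3 * (q : ℝ) ^ (2 * R)) := by ring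
      _ ≤ (q : ℝ) ^ n := by linarith
  have hlog0 : 0 ≤ Real.log n := Real.log_nonneg hn1
  set W : ℝ := (q : ℝ) ^ n / V with hW
  have hW0 : 0 < W := by positivity
  have hQW : (q : ℝ) ^ n = W * V := by rw [hW]; field_simp
  have hn23 : (n : ℝ) ^ 2 ≤ (n : ℝ) ^ 3 := pow_le_pow_right₀ hn1 (by norm_num)
  have hn3 : (n : ℝ) ≤ (n : ℝ) ^ 3 := le_self_pow₀ hn1 (by norm_num)
  have hsmallW : 3 * (n : ℝ) ^ 3 * V ≤ W := by
    rw [hW, le_div_iff₀ hV0]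
    linarith [show 3 * (n : ℝ) ^ 3 * V * V = 3 * (n : ℝ) ^ 3 * V ^ 2 by ring]
  have hn3V : (n : ℝ) ^ 3 ≤ (n : ℝ) ^ 3 * V := le_mul_of_one_le_right (by positivity) hV1
  set a : ℝ := (n : ℝ) ^ 2 / W with ha
  have ha0 : 0 < a := by positivity
  have ha1 : a ≤ 1 := by
    rw [ha, div_le_one hW0]
    linarith
  have haV : a * (q : ℝ) ^ n = ((n ^ 2 : ℕ) : ℝ) * V := by
    rw [hQW, ha]; push_cast; field_simp
  set m : ℕ := ⌈((R : ℝ) + 1) * Real.log n / a⌉₊ with hm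
  have hm1 : ((R : ℝ) + 1) * Real.log n / a ≤ m := Nat.le_ceil _
  have hm2 : (m : ℝ) ≤ ((R : ℝ) + 1) * Real.log n / a + 1 :=
    (Nat.ceil_lt_add_one (by positivity)).le
  have hexp : Real.exp (-(a * m)) ≤ 1 / (n : ℝ) ^ (R + 1) := by
    rw [div_le_iff₀ ha0] at hm1
    calc Real.exp (-(a * m)) ≤ Real.exp (-(((R + 1 : ℕ) : ℝ) * Real.log n)) := by
          apply Real.exp_le_exp.2
          push_cast
          linarith
      _ = 1 / (n : ℝ) ^ (R + 1) := by
          rw [Real.exp_neg, Real.exp_nat_mul, Real.exp_log hn0, one_div]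
  have hmain := deBruijnCoveringNumber_le hq (by omega) (show R ≤ n by omega) (n ^ 2) m haV ha1
  have hpart1 : (m : ℝ) * (((n ^ 2 : ℕ) : ℝ) + n) ≤
      ((R : ℝ) + 1) * Real.log n * W + ((R : ℝ) + 1) * W + (n : ℝ) ^ 2 + n := by
    push_cast
    have hln : Real.log n / n ≤ 1 := by
      rw [div_le_one hn0]
      exact Real.log_le_self hn0.le
    calc (m : ℝ) * ((n : ℝ) ^ 2 + n)
        ≤ (((R : ℝ) + 1) * Real.log n / a + 1) * ((n : ℝ) ^ 2 + n) := by gcongr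
      _ = ((R : ℝ) + 1) * Real.log n * W + ((R : ℝ) + 1) * W * (Real.log n / n) +
            (n : ℝ) ^ 2 + n := by
          rw [ha]; field_simp
          ring
      _ ≤ _ := by
          have : ((R : ℝ) + 1) * W * (Real.log n / n) ≤ ((R : ℝ) + 1) * W :=
            mul_le_of_le_one_right (by positivity) hln
          linarith
  have hpart2 : (n : ℝ) * ((q : ℝ) ^ n * (Real.exp (-(a * m)) + a)) ≤
      W * (q : ℝ) ^ R + (n : ℝ) ^ 3 * V := by
    calc (n : ℝ) * ((q : ℝ) ^ n * (Real.exp (-(a * m)) + a))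
        ≤ (n : ℝ) * ((q : ℝ) ^ n * (1 / (n : ℝ) ^ (R + 1) + a)) := by gcongr
      _ = W * (V / (n : ℝ) ^ R) + (n : ℝ) ^ 3 * V := by
          rw [mul_add ((q : ℝ) ^ n), mul_comm _ a, haV, hQW]
          push_cast
          field_simp
          ring
      _ ≤ _ := by
          gcongr
          rw [div_le_iff₀ (by positivity)]
          linarith
  have hfin := mul_le_mul_of_nonneg_left h2 hW0.le
  have hgoal : ((R : ℝ) + 1 + ε) * (q : ℝ) ^ n * Real.log n / V =
      ((R : ℝ) + 1) * Real.log n * W + W * (ε * Real.log n) := by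
    rw [hQW]; field_simp
  rw [hgoal]
  linarith
end

section
/- Let q ≥ 2, n ≥ 1, R ≥ 0, M ≥ 1 be integers, let A be the least nonnegative residue of n modulo M and B the least nonnegative residue of −n modulo M, and suppose min{A, B} ≤ n − 2R − 1. Then there is no (n,R,q)-de Bruijn covering code of length M; in particular M(n,R,q) ≠ M. -/
/-- The sum of `c` over the cyclic window of length `L` starting at index `i`. -/
def windowSum {M : ℕ} (c : ZMod M → ℕ) (L : ℕ) (i : ZMod M) : ℕ :=
  ∑ t ∈ Finset.range L, c (i + (t : ℕ))

/-- The indicator function of the nonzero positions of `S`. -/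
def nonzeroIndicator {M q : ℕ} (S : ZMod M → Fin q) (x : ZMod M) : ℕ :=
  if (S x).val = 0 then 0 else 1

theorem windowSum_add {M : ℕ} (c : ZMod M → ℕ) (L K : ℕ) (i : ZMod M) :
    windowSum c (L + K) i = windowSum c L i + windowSum c K (i + (L : ℕ)) := by
  simp [windowSum, Finset.sum_range_add, add_assoc]

theorem windowSum_le {M : ℕ} {c : ZMod M → ℕ} (hc : ∀ x, c x ≤ 1) (L : ℕ) (i : ZMod M) :
    windowSum c L i ≤ L := by
  simpa [windowSum] using Finset.sum_le_sum (s := Finset.range L) fun t _ => hc (i + (t : ℕ))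

theorem windowSum_add_one_of_dvd {M : ℕ} (c : ZMod M → ℕ) {L : ℕ} (hL : M ∣ L) (i : ZMod M) :
    windowSum c L (i + 1) = windowSum c L i := by
  have h1 := windowSum_add c 1 L i
  have h2 := windowSum_add c L 1 i
  have h0 : (L : ZMod M) = 0 := (ZMod.natCast_eq_zero_iff L M).mpr hL
  rw [h0, add_zero] at h2
  rw [add_comm 1 L, Nat.cast_one] at h1
  omega

/-- A window whose length is a multiple of the period has the same sum wherever it starts. -/
theorem windowSum_eq_of_dvd {M : ℕ} [NeZero M] (c : ZMod M → ℕ) {L : ℕ} (hL : M ∣ L)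
    (i j : ZMod M) : windowSum c L i = windowSum c L j := by
  have key : ∀ k : ℕ, windowSum c L (j + (k : ℕ)) = windowSum c L j := by
    intro k
    induction k with
    | zero => simp
    | succ k ih => rw [Nat.cast_succ, ← add_assoc, windowSum_add_one_of_dvd c hL, ih]
  simpa using key (i - j).val

theorem windowSum_le_add_of_dvd_sub {M : ℕ} [NeZero M] {c : ZMod M → ℕ} (hc : ∀ x, c x ≤ 1)
    {n r : ℕ} (hr : r ≤ n) (h : M ∣ n - r) (i j : ZMod M) :
    windowSum c n i ≤ windowSum c n j + r := by
  have hi := windowSum_add c (n - r) r i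
  have hj := windowSum_add c (n - r) r j
  rw [Nat.sub_add_cancel hr] at hi hj
  have := windowSum_eq_of_dvd c h i j
  have := windowSum_le hc r (i + ((n - r : ℕ) : ZMod M))
  omega

theorem windowSum_le_add_of_dvd_add {M : ℕ} [NeZero M] {c : ZMod M → ℕ} (hc : ∀ x, c x ≤ 1)
    {n r : ℕ} (h : M ∣ n + r) (i j : ZMod M) :
    windowSum c n i ≤ windowSum c n j + r := by
  have hi := windowSum_add c n r i
  have hj := windowSum_add c n r j
  have := windowSum_eq_of_dvd c h i j
  have := windowSum_le hc r (j + (n : ZMod M))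
  omega

theorem hammingDist_cyclicWindow_zero {M q n : ℕ} (hq : 0 < q) (S : ZMod M → Fin q)
    (i : ZMod M) :
    hammingDist (cyclicWindow q n S i) (fun _ => ⟨0, hq⟩) =
      windowSum (nonzeroIndicator S) n i := by
  rw [windowSum, ← Fin.sum_univ_eq_sum_range fun t => nonzeroIndicator S (i + (t : ℕ)),
    hammingDist, Finset.card_filter]
  refine Finset.sum_congr rfl fun t _ => ?_
  simp [cyclicWindow, nonzeroIndicator, Fin.ext_iff]

theorem le_hammingDist_cyclicWindow_one_add {M q n : ℕ} (hq : 1 < q) (S : ZMod M → Fin q)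
    (i : ZMod M) :
    n ≤ hammingDist (cyclicWindow q n S i) (fun _ => ⟨1, hq⟩) +
      windowSum (nonzeroIndicator S) n i := by
  rw [windowSum, ← Fin.sum_univ_eq_sum_range fun t => nonzeroIndicator S (i + (t : ℕ)),
    hammingDist, Finset.card_filter, ← Finset.sum_add_distrib]
  calc n = ∑ _t : Fin n, 1 := by simp
    _ ≤ _ := Finset.sum_le_sum fun t _ => by
      simp only [cyclicWindow, nonzeroIndicator, Fin.ext_iff, ne_eq]
      split_ifs <;> omega

/-- If `A` and `B` are the least nonnegative residues of `n` and `-n` modulo `M` and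
`min{A,B} ≤ n - 2R - 1`, then no `(n,R,q)`-de Bruijn covering code of length `M` exists;
in particular `M(n,R,q) ≠ M`. -/
theorem stmt15 (q n R M : ℕ) (hq : 2 ≤ q) (hn : 1 ≤ n) (hM : 0 < M)
    (hmin : (min (((n : ℤ) % (M : ℤ)).toNat) (((-(n : ℤ)) % (M : ℤ)).toNat) : ℤ) ≤
      (n : ℤ) - 2 * (R : ℤ) - 1) :
    (∀ S : ZMod M → Fin q, ¬ IsDeBruijnCoveringCode q n R M S) ∧
    deBruijnCoveringNumber q n R ≠ M := by
  have hno : ∀ S : ZMod M → Fin q, ¬ IsDeBruijnCoveringCode q n R M S := by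
    intro S hS
    obtain ⟨i, hi⟩ := hS fun _ => ⟨0, by omega⟩
    obtain ⟨j, hj⟩ := hS fun _ => ⟨1, by omega⟩
    rw [hammingDist_cyclicWindow_zero] at hi
    have hj' := le_hammingDist_cyclicWindow_one_add (by omega) S j (n := n)
    have : NeZero M := ⟨by omega⟩
    have hMpos : (0 : ℤ) < M := by exact_mod_cast hM
    have hc : ∀ x, nonzeroIndicator S x ≤ 1 := fun x => by
      unfold nonzeroIndicator; split <;> omega
    have hA := Int.emod_nonneg (n : ℤ) hMpos.ne'
    have hB := Int.emod_nonneg (-(n : ℤ)) hMpos.ne'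
    rcases min_le_iff.mp hmin with h | h
    · obtain ⟨A, hAeq⟩ := Int.eq_ofNat_of_zero_le hA
      have hle : n % M ≤ n := Nat.mod_le n M
      have hmod : ((n % M : ℕ) : ℤ) = (n : ℤ) % M := by push_cast; rfl
      have hw := windowSum_le_add_of_dvd_sub hc hle (Nat.dvd_sub_mod n) j i
      omega
    · obtain ⟨B, hBeq⟩ := Int.eq_ofNat_of_zero_le hB
      have hdvd : M ∣ n + B := by
        have h1 : (M : ℤ) ∣ -(n : ℤ) - -(n : ℤ) % M := Int.dvd_self_sub_emod
        rw [hBeq] at h1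
        have h2 : (M : ℤ) ∣ ((n + B : ℕ) : ℤ) := by
          rw [show ((n + B : ℕ) : ℤ) = -(-(n : ℤ) - (B : ℤ)) by push_cast; ring]
          exact (dvd_neg (α := ℤ)).mpr h1
        exact_mod_cast h2
      have hw := windowSum_le_add_of_dvd_add hc hdvd j i
      omega
  refine ⟨hno, fun h => ?_⟩
  have hne : {M : ℕ | 0 < M ∧ ∃ S : ZMod M → Fin q, IsDeBruijnCoveringCode q n R M S}.Nonempty :=
    Nat.nonempty_of_pos_sInf (by unfold deBruijnCoveringNumber at h; omega)
  have hmem := Nat.sInf_mem hne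
  unfold deBruijnCoveringNumber at h
  rw [h] at hmem
  obtain ⟨-, S, hS⟩ := hmem
  exact hno S hS
end

section
/- Let a ≥ 2, s ≥ 1, n ≥ 1, R ≥ 0 be integers and let b = a^s. Then M(n,R,b) ≤ s²·⌈(M(sn,R,a) + sn)/s⌉ − s: from any (sn,R,a)-de Bruijn covering code of minimal length one can construct an (n,R,a^s)-de Bruijn covering code over the alphabet of size a^s of length s²⌈(M(sn,R,a)+sn)/s⌉ − s, by grouping symbols in blocks of s via a bijection σ between {0,…,a−1}^s and {0,…,a^s−1}. -/
/-- A function on `ℕ` whose windows inside `[0, L)` cover all words gives a cyclic code of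
length `L`. -/
theorem exists_isDeBruijnCoveringCode_of_nat {q n R L : ℕ} (f : ℕ → Fin q)
    (h : ∀ v : Fin n → Fin q, ∃ i, i + n ≤ L ∧ hammingDist (fun t : Fin n => f (i + t)) v ≤ R) :
    ∃ S : ZMod L → Fin q, IsDeBruijnCoveringCode q n R L S := by
  refine ⟨fun z => f z.val, fun v => ?_⟩
  obtain ⟨i, hi, hv⟩ := h v
  refine ⟨(i : ZMod L), ?_⟩
  convert hv using 2
  funext t
  have ht : i + (t : ℕ) < L := by omega
  rw [cyclicWindow, ← Nat.cast_add, ZMod.val_natCast, Nat.mod_eq_of_lt ht]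

/-- Concatenating all words of length `n` gives a covering code. -/
theorem exists_pos_isDeBruijnCoveringCode {q n : ℕ} (R : ℕ) (hq : 0 < q) (hn : 0 < n) :
    ∃ M : ℕ, 0 < M ∧ ∃ S : ZMod M → Fin q, IsDeBruijnCoveringCode q n R M S := by
  have hpow : 0 < q ^ n := pow_pos hq n
  refine ⟨q ^ n * n, by positivity, exists_isDeBruijnCoveringCode_of_nat
    (fun p => finFunctionFinEquiv.symm ⟨p / n % q ^ n, Nat.mod_lt _ hpow⟩
      ⟨p % n, Nat.mod_lt _ hn⟩) fun v => ?_⟩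
  have hlt := (finFunctionFinEquiv v).isLt
  refine ⟨finFunctionFinEquiv v * n, ?_, ?_⟩
  · rw [← Nat.succ_mul]
    exact Nat.mul_le_mul_right n hlt
  · refine (hammingDist_eq_zero.2 (funext fun t => ?_)).trans_le (Nat.zero_le R)
    have hdiv : (finFunctionFinEquiv v * n + t : ℕ) / n % q ^ n = finFunctionFinEquiv v := by
      rw [mul_comm, Nat.mul_add_div hn, Nat.div_eq_of_lt t.isLt, add_zero, Nat.mod_eq_of_lt hlt]
    have hmod : (finFunctionFinEquiv v * n + t : ℕ) % n = t := by
      rw [mul_comm, Nat.mul_add_mod, Nat.mod_eq_of_lt t.isLt]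
    simp only [hdiv, hmod, Fin.eta, Equiv.symm_apply_apply]

/-- Grouping coordinates in blocks of length `s` does not increase the Hamming distance. -/
theorem hammingDist_blocks_le {α : Type*} [DecidableEq α] {s n : ℕ}
    (x y : Fin (s * n) → α) (u v : Fin n → Fin s → α)
    (hx : ∀ (t : Fin n) (j : Fin s) (h : s * t + j < s * n), x ⟨s * t + j, h⟩ = u t j)
    (hy : ∀ (t : Fin n) (j : Fin s) (h : s * t + j < s * n), y ⟨s * t + j, h⟩ = v t j) :
    hammingDist u v ≤ hammingDist x y := by
  refine Finset.card_le_card_of_surjOn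
    (fun k : Fin (s * n) => ⟨k / s, Nat.div_lt_of_lt_mul k.isLt⟩) fun t ht => ?_
  simp only [Finset.coe_filter, Finset.mem_univ, true_and, Set.mem_ofPred_eq] at ht
  obtain ⟨j, hj⟩ := Function.ne_iff.1 ht
  have hlt : s * t + j < s * n := calc
    s * t + j < s * (t + 1) := by rw [Nat.mul_succ]; omega
    _ ≤ s * n := Nat.mul_le_mul_left s t.isLt
  refine ⟨⟨s * t + j, hlt⟩, ?_, Fin.ext ?_⟩
  · simpa [hx t j hlt, hy t j hlt] using hj
  · change (s * t + j : ℕ) / s = t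
    rw [Nat.mul_add_div (Nat.zero_lt_of_lt j.isLt), Nat.div_eq_of_lt j.isLt, add_zero]

/-- Cutting a covering code over `Fin a` into blocks of length `s`, once for each of the `s`
offsets, and concatenating the results gives a covering code over `Fin (a ^ s)`. -/
theorem IsDeBruijnCoveringCode.exists_blocks {a s n R M K : ℕ} (hs : 0 < s) (hM : 0 < M)
    (hK : M + s * n ≤ s * K) {S : ZMod M → Fin a}
    (hS : IsDeBruijnCoveringCode a (s * n) R M S) :
    ∃ T : ZMod (s * K) → Fin (a ^ s), IsDeBruijnCoveringCode (a ^ s) n R (s * K) T := by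
  have : NeZero M := ⟨hM.ne'⟩
  refine exists_isDeBruijnCoveringCode_of_nat (fun p => finFunctionFinEquiv
    fun j : Fin s => S ((p / K + s * (p % K) + j : ℕ) : ZMod M)) fun v => ?_
  obtain ⟨i, hi⟩ := hS fun k => finFunctionFinEquiv.symm
    (v ⟨k / s, Nat.div_lt_of_lt_mul k.isLt⟩) ⟨k % s, Nat.mod_lt _ hs⟩
  have hoff : i.val % s < s := Nat.mod_lt _ hs
  have hsplit : s * (i.val / s) + i.val % s = i.val := Nat.div_add_mod _ _
  have hblock : i.val / s + n ≤ K := by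
    refine Nat.le_of_mul_le_mul_left ?_ hs
    have := i.val_lt
    rw [Nat.mul_add]
    omega
  refine ⟨K * (i.val % s) + i.val / s, ?_, ?_⟩
  · have : K * (i.val % s + 1) ≤ K * s := Nat.mul_le_mul_left K hoff
    rw [Nat.mul_succ] at this
    rw [mul_comm s K]
    omega
  · rw [← hammingDist_comp (fun _ => finFunctionFinEquiv.symm)
      fun _ => finFunctionFinEquiv.symm.injective]
    refine (hammingDist_blocks_le _ _ _ _ (fun t j h => ?_) fun t j h => ?_).trans hi
    · have ht : i.val / s + t < K := by omega
      have hK0 : 0 < K := Nat.zero_lt_of_lt ht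
      rw [Equiv.symm_apply_apply, add_assoc (K * _), Nat.mul_add_div hK0, Nat.mul_add_mod,
        Nat.div_eq_of_lt ht, Nat.mod_eq_of_lt ht, cyclicWindow]
      have hpos : i.val % s + 0 + s * (i.val / s + t) + j = i.val + (s * t + j) := by
        rw [Nat.mul_add]
        omega
      rw [hpos, Nat.cast_add i.val, ZMod.natCast_rightInverse i]
    · have hdiv : (s * t + j : ℕ) / s = t := by
        rw [Nat.mul_add_div hs, Nat.div_eq_of_lt j.isLt, add_zero]
      have hmod : (s * t + j : ℕ) % s = j := by
        rw [Nat.mul_add_mod, Nat.mod_eq_of_lt j.isLt]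
      simp only [hdiv, hmod, Fin.eta]

/-- For `b = aˢ`, `M(n,R,b) ≤ s² ⌈(M(sn,R,a) + sn)/s⌉ - s`. -/
theorem stmt19 (a s n R : ℕ) (ha : 2 ≤ a) (hs : 1 ≤ s) (hn : 1 ≤ n) :
    deBruijnCoveringNumber (a ^ s) n R ≤
      s ^ 2 * ((deBruijnCoveringNumber a (s * n) R + s * n + s - 1) / s) - s := by
  obtain ⟨hM, S, hS⟩ := Nat.sInf_mem
    (exists_pos_isDeBruijnCoveringCode (q := a) (n := s * n) R (by omega) (by positivity))
  change 0 < deBruijnCoveringNumber a (s * n) R at hM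
  obtain rfl | hs2 := hs.eq_or_lt
  · simp only [pow_one, one_mul, Nat.div_one, one_pow]
    omega
  set M := deBruijnCoveringNumber a (s * n) R
  set K := (M + s * n + s - 1) / s
  have hK : M + s * n ≤ s * K := by
    have : M + s * n + s - 1 < s * (K + 1) := Nat.lt_mul_div_succ _ hs
    rw [Nat.mul_succ] at this
    omega
  have hK0 : 0 < K := Nat.pos_of_mul_pos_left (hM.trans_le (le_self_add.trans hK))
  calc deBruijnCoveringNumber (a ^ s) n R ≤ s * K :=
        Nat.sInf_le ⟨by positivity, hS.exists_blocks hs hM hK⟩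
    _ ≤ s ^ 2 * K - s := by
        refine Nat.le_sub_of_add_le ?_
        nlinarith [Nat.mul_le_mul (Nat.mul_le_mul_left s hs2) hK0, Nat.mul_le_mul_left s hK0,
          Nat.mul_le_mul_right K (Nat.mul_le_mul_left s hs2)]
end
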